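/- Let A be a C*-algebra and n ≥ 1. If Mₙ(A) has commutator bounds (m, C), then A has commutator bounds (m·n², C·n). -/

import Mathlib

/-- The commutator-bound property `(m, C)` of a complex normed algebra, relative to a
norm function `Nm` on it: every `h` in the `Nm`-closure of the linear span of
commutators is, up to `ε`, a sum of `m` commutators `[xᵢ, yᵢ]` with
`Σ Nm xᵢ · Nm yᵢ ≤ C · Nm h`. -/
def HasCommBoundsWith {B : Type*} [NonUnitalRing B] [Module ℂ B]
    (Nm : B → ℝ) (m : ℕ) (C : ℝ) : Prop :=
  ∀ h : B,
    (∀ ε > 0, ∃ g ∈ (Submodule.span ℂ {z : B | ∃ x y : B, z = x * y - y * x} : Set B),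
      Nm (h - g) < ε) →
    ∀ ε > 0, ∃ x y : Fin m → B,
      Nm (h - ∑ i, (x i * y i - y i * x i)) < ε ∧
      ∑ i, Nm (x i) * Nm (y i) ≤ C * Nm h

section CStarNorm

variable {A : Type*} [NonUnitalCStarAlgebra A]

/-- A function satisfying the axioms of a C*-norm, not assumed to be complete. -/
structure IsCStarNorm (N : A → ℝ) : Prop where
  nonneg : ∀ a, 0 ≤ N a
  eq_zero : ∀ a, N a = 0 → a = 0
  add_le : ∀ a b, N (a + b) ≤ N a + N b
  smul : ∀ (c : ℂ) (a), N (c • a) = ‖c‖ * N a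
  mul_le : ∀ a b, N (a * b) ≤ N a * N b
  cstar : ∀ a, N (star a * a) = N a * N a

namespace IsCStarNorm

variable {N : A → ℝ}

lemma le_star (hN : IsCStarNorm N) (a : A) : N a ≤ N (star a) := by
  rcases (hN.nonneg a).eq_or_lt with h | h
  · rw [← h]
    exact hN.nonneg _
  · have h1 := hN.mul_le (star a) a
    rw [hN.cstar] at h1
    exact le_of_mul_le_mul_right h1 h

lemma star_eq (hN : IsCStarNorm N) (a : A) : N (star a) = N a :=
  le_antisymm (by simpa using hN.le_star (star a)) (hN.le_star a)

/-- For self-adjoint `a`, the element `v = a² + i a √(‖a‖² - a²)` satisfies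
`v⋆ v = ‖a‖² a²` and has real part `a²`. -/
lemma le_norm_of_isSelfAdjoint (hN : IsCStarNorm N) {a : A} (ha : IsSelfAdjoint a) :
    N a ≤ ‖a‖ := by
  have hf : Continuous fun t : ℝ => t * √(‖a‖ ^ 2 - t ^ 2) := by fun_prop
  set b : A := cfcₙ (fun t : ℝ => t * √(‖a‖ ^ 2 - t ^ 2)) a with hb
  have hbs : star b = b := (cfcₙ_predicate (R := ℝ) (p := IsSelfAdjoint) _ a).star_eq
  have hcomm : a * b = b * a := by
    have h := cfcₙ_commute_cfcₙ (R := ℝ) id (fun t : ℝ => t * √(‖a‖ ^ 2 - t ^ 2)) a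
    rw [cfcₙ_id ℝ a] at h
    exact h.eq
  have hsq : b * b + a * a * (a * a) = ((‖a‖ ^ 2 : ℝ) : ℂ) • (a * a) := by
    have h2 : a * a = cfcₙ (fun t : ℝ => t * t) a := by
      rw [cfcₙ_mul (fun t : ℝ => t) (fun t : ℝ => t) a]
      rw [cfcₙ_id' ℝ a]
    rw [h2, hb, ← cfcₙ_mul .., ← cfcₙ_mul .., ← cfcₙ_add .., Complex.coe_smul,
      ← cfcₙ_smul ..]
    refine cfcₙ_congr fun t ht => ?_
    have hta : ‖t‖ ≤ ‖a‖ := by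
      have h := norm_apply_le_norm_cfcₙ (fun t : ℝ => t) a ht
      rwa [cfcₙ_id' ℝ a] at h
    have hs : √(‖a‖ ^ 2 - t ^ 2) * √(‖a‖ ^ 2 - t ^ 2) = ‖a‖ ^ 2 - t ^ 2 := by
      refine Real.mul_self_sqrt (sub_nonneg.2 ?_)
      rw [← sq_abs t]
      exact pow_le_pow_left₀ (abs_nonneg t) hta 2
    simp only [smul_eq_mul]
    linear_combination t ^ 2 * hs
  set v : A := a * a + Complex.I • b with hv
  have hvs : star v = a * a - Complex.I • b := by
    simp [hv, ha.star_eq, hbs, sub_eq_add_neg]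
  have hvv : star v * v = ((‖a‖ ^ 2 : ℝ) : ℂ) • (a * a) := by
    have hc : a * a * b = b * (a * a) := by
      rw [mul_assoc, hcomm, ← mul_assoc, hcomm, mul_assoc]
    rw [← hsq, hvs, hv]
    simp only [sub_mul, mul_add, smul_mul_assoc, mul_smul_comm, smul_sub, smul_smul,
      Complex.I_mul_I, hc, neg_smul, one_smul]
    abel
  have haa : N (a * a) = N a * N a := by
    simpa [ha.star_eq] using hN.cstar a
  have hNv : N v = ‖a‖ * N a := by
    have h := hN.cstar v
    rw [hvv, hN.smul, haa, Complex.norm_real, Real.norm_of_nonneg (by positivity)] at h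
    refine (mul_self_inj (hN.nonneg v) (mul_nonneg (norm_nonneg a) (hN.nonneg a))).1 ?_
    rw [← h]
    ring
  have hre : (2 : ℂ) • (a * a) = v + star v := by
    rw [hvs, hv, two_smul]
    abel
  have h2 := hN.add_le v (star v)
  rw [← hre, hN.smul, haa, hN.star_eq, hNv, Complex.norm_ofNat] at h2
  rcases (hN.nonneg a).eq_or_lt with h | h
  · rw [← h]
    exact norm_nonneg a
  · exact le_of_mul_le_mul_right (by linarith) h

lemma norm_le_of_isSelfAdjoint (hN : IsCStarNorm N) {a : A} (ha : IsSelfAdjoint a) :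
    ‖a‖ ≤ N a := by
  refine le_of_forall_gt_imp_ge_of_dense fun s hs => ?_
  have hs0 : 0 < s := (hN.nonneg a).trans_lt hs
  have hmax : ∀ t : ℝ, max |t| s ^ 2 ≠ 0 := fun t =>
    pow_ne_zero 2 (hs0.trans_le (le_max_right _ _)).ne'
  have hr : Continuous fun t : ℝ => t / max |t| s ^ 2 :=
    continuous_id.div (by fun_prop) hmax
  have hc : Continuous fun t : ℝ => max (|t| - s) 0 := by fun_prop
  have hc0 : max (|(0 : ℝ)| - s) 0 = 0 := by simp [hs0.le]
  set r : A := cfcₙ (fun t : ℝ => t / max |t| s ^ 2) a with hrdef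
  set c : A := cfcₙ (fun t : ℝ => max (|t| - s) 0) a with hcdef
  have hrc : r * a * c = c := by
    have h2 : r * a = cfcₙ (fun t : ℝ => t / max |t| s ^ 2 * t) a := by
      rw [cfcₙ_mul (fun t : ℝ => t / max |t| s ^ 2) (fun t : ℝ => t) a hr.continuousOn (by simp),
        cfcₙ_id' ℝ a]
    have hrt : Continuous fun t : ℝ => t / max |t| s ^ 2 * t := hr.mul continuous_id
    rw [h2, hcdef, ← cfcₙ_mul _ _ a hrt.continuousOn (by simp) hc.continuousOn hc0]
    refine cfcₙ_congr fun t _ => ?_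
    rcases le_total |t| s with h | h
    · simp [h]
    · have ht : t ^ 2 ≠ 0 := by
        have := hmax t
        rwa [max_eq_left h, sq_abs] at this
      simp only [max_eq_left h, sq_abs]
      rw [div_mul_eq_mul_div, ← sq, div_self ht, one_mul]
  have hNr : N r ≤ s⁻¹ := by
    refine (hN.le_norm_of_isSelfAdjoint (cfcₙ_predicate _ a)).trans ?_
    refine norm_cfcₙ_le fun t _ => ?_
    have hm : 0 < max |t| s := hs0.trans_le (le_max_right _ _)
    rw [norm_div, norm_pow, Real.norm_eq_abs, Real.norm_of_nonneg hm.le,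
      div_le_iff₀ (by positivity), inv_mul_eq_div, le_div_iff₀ hs0, sq]
    exact mul_le_mul (le_max_left _ _) (le_max_right _ _) hs0.le hm.le
  have hNc : N c = 0 := by
    by_contra hne
    have hpos : 0 < N c := lt_of_le_of_ne (hN.nonneg c) (Ne.symm hne)
    have h1 : N c ≤ s⁻¹ * N a * N c :=
      calc N c = N (r * a * c) := by rw [hrc]
        _ ≤ N r * N a * N c := (hN.mul_le _ _).trans
          (mul_le_mul_of_nonneg_right (hN.mul_le _ _) hpos.le)
        _ ≤ s⁻¹ * N a * N c := by
          gcongr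
          exact hN.nonneg a
    have h2 : s⁻¹ * N a < 1 := by rwa [inv_mul_lt_iff₀ hs0, mul_one]
    nlinarith
  have hczero : c = 0 := hN.eq_zero c hNc
  rw [← cfcₙ_id' ℝ a]
  refine norm_cfcₙ_le fun t ht => ?_
  have h := norm_apply_le_norm_cfcₙ (fun t : ℝ => max (|t| - s) 0) a ht hc.continuousOn hc0
  rw [← hcdef, hczero, norm_zero, Real.norm_of_nonneg (le_max_right _ _)] at h
  simpa using (le_max_left _ _).trans h

/-- A C*-algebra has a unique C*-norm, even among incomplete ones. -/
theorem eq_norm (hN : IsCStarNorm N) (a : A) : N a = ‖a‖ := by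
  have ha : IsSelfAdjoint (star a * a) := .star_mul_self a
  have h := (hN.le_norm_of_isSelfAdjoint ha).antisymm (hN.norm_le_of_isSelfAdjoint ha)
  rw [hN.cstar, CStarRing.norm_star_mul_self] at h
  exact (mul_self_inj (hN.nonneg a) (norm_nonneg a)).1 h

end IsCStarNorm

end CStarNorm

section MatrixNorm

open Matrix

variable {A ι : Type*} [Fintype ι]

lemma Matrix.norm_apply_le_of_norm_single [DecidableEq ι] [NonUnitalCStarAlgebra A]
    {Nm : Matrix ι ι A → ℝ}
    (hmul : ∀ X Y, Nm (X * Y) ≤ Nm X * Nm Y) (hcstar : ∀ X, Nm (Xᴴ * X) = Nm X * Nm X)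
    (hnonneg : ∀ X, 0 ≤ Nm X) (hsingle : ∀ i a, Nm (single i i a) = ‖a‖)
    (X : Matrix ι ι A) (i j : ι) : ‖X i j‖ ≤ Nm X := by
  have hoff : ∀ a, Nm (single i j a) = ‖a‖ := fun a => by
    have h := hcstar (single i j a)
    rw [conjTranspose_single, single_mul_single_same, hsingle,
      CStarRing.norm_star_mul_self] at h
    exact ((mul_self_inj (norm_nonneg a) (hnonneg _)).1 h).symm
  set x := X i j with hx
  have hcorner : single i i (star x) * X * single j j (star x) =
      single i j (star x * x * star x) := by
    rw [single_mul_mul_single]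
  have h1 : ‖star x * x * star x‖ ≤ ‖x‖ * Nm X * ‖x‖ := by
    rw [← hoff, ← hcorner]
    refine (hmul _ _).trans ?_
    rw [hsingle, norm_star]
    gcongr
    refine (hmul _ _).trans ?_
    rw [hsingle, norm_star]
  have h2 : ‖x‖ * ‖x‖ * (‖x‖ * ‖x‖) ≤ ‖x‖ * Nm X * ‖x‖ * ‖x‖ := by
    have h := CStarRing.norm_star_mul_self (x := star x * x)
    rw [(IsSelfAdjoint.star_mul_self x).star_eq, CStarRing.norm_star_mul_self,
      ← mul_assoc (star x * x)] at h
    rw [← h]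
    exact (norm_mul_le _ _).trans (mul_le_mul_of_nonneg_right h1 (norm_nonneg x))
  rcases (norm_nonneg x).eq_or_lt with h | h
  · rw [← h]
    exact hnonneg X
  · refine le_of_mul_le_mul_right ?_ (pow_pos h 3)
    linarith

lemma Matrix.trace_mul_sub_mul [NonUnitalRing A] (X Y : Matrix ι ι A) :
    trace (X * Y - Y * X) = ∑ p : ι × ι, (X p.1 p.2 * Y p.2 p.1 - Y p.2 p.1 * X p.1 p.2) := by
  rw [trace_sub, Finset.sum_sub_distrib, Fintype.sum_prod_type, Fintype.sum_prod_type_right]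
  simp [trace, mul_apply]

end MatrixNorm

/-- If `Mₙ(A)` (with its unique C*-norm, represented by a function
`Nm` satisfying the C*-norm axioms) has commutator bounds `(m, C)`, then `A` has
commutator bounds `(m·n², C·n)`. -/
theorem statement2 {A : Type*} [NonUnitalCStarAlgebra A] (n : ℕ) (hn : 0 < n)
    (m : ℕ) (C : ℝ)
    (Nm : Matrix (Fin n) (Fin n) A → ℝ)
    (hNnonneg : ∀ X, 0 ≤ Nm X)
    (hNdef : ∀ X, Nm X = 0 ↔ X = 0)
    (hNadd : ∀ X Y, Nm (X + Y) ≤ Nm X + Nm Y)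
    (hNsmul : ∀ (c : ℂ) (X), Nm (c • X) = ‖c‖ * Nm X)
    (hNmul : ∀ X Y, Nm (X * Y) ≤ Nm X * Nm Y)
    (hNcstar : ∀ X, Nm (X.conjTranspose * X) = Nm X * Nm X)
    (hMn : HasCommBoundsWith Nm m C) :
    HasCommBoundsWith (fun a : A => ‖a‖) (m * n ^ 2) (C * n) := by
  let D : A → Matrix (Fin n) (Fin n) A := fun a => Matrix.diagonal fun _ => a
  have hsingle : ∀ i a, Nm (Matrix.single i i a) = ‖a‖ := fun i => by
    refine IsCStarNorm.eq_norm (N := fun a => Nm (Matrix.single i i a))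
      ⟨fun a => hNnonneg _, fun a h => ?_, fun a b => ?_, fun c a => ?_, fun a b => ?_,
        fun a => ?_⟩
    · simpa using congrFun (congrFun ((hNdef _).1 h) i) i
    · simpa only [Matrix.single_add] using hNadd _ _
    · simpa only [Matrix.smul_single] using hNsmul c (Matrix.single i i a)
    · simpa only [Matrix.single_mul_single_same] using
        hNmul (Matrix.single i i a) (Matrix.single i i b)
    · simpa only [Matrix.conjTranspose_single, Matrix.single_mul_single_same] using
        hNcstar (Matrix.single i i a)
  have hentry := Matrix.norm_apply_le_of_norm_single hNmul hNcstar hNnonneg hsingle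
  have hDmul : ∀ a b, D (a * b) = D a * D b := fun a b => by simp [D]
  have hDadd : ∀ a b, D (a + b) = D a + D b := fun a b => by simp [D]
  have hDsub : ∀ a b, D (a - b) = D a - D b := fun a b => by simp [D]
  have hDsmul : ∀ (c : ℂ) a, D (c • a) = c • D a := fun c a => by
    simp only [D, ← Matrix.diagonal_smul]
    rfl
  have hDstar : ∀ a, D (star a) = (D a).conjTranspose := fun a => by
    simp only [D, Matrix.diagonal_conjTranspose]
    rfl
  have hDnorm : ∀ a, Nm (D a) = ‖a‖ := by
    refine IsCStarNorm.eq_norm (N := fun a => Nm (D a))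
      ⟨fun a => hNnonneg _, fun a h => ?_, fun a b => ?_, fun c a => ?_, fun a b => ?_,
        fun a => ?_⟩
    · simpa [D] using congrFun (congrFun ((hNdef _).1 h) ⟨0, hn⟩) ⟨0, hn⟩
    · simpa only [hDadd] using hNadd _ _
    · simpa only [hDsmul] using hNsmul _ _
    · simpa only [hDmul] using hNmul _ _
    · simpa only [hDmul, hDstar] using hNcstar _
  intro h hclosure ε hε
  have hDspan : ∀ g ∈ Submodule.span ℂ {z : A | ∃ x y : A, z = x * y - y * x},
      D g ∈ Submodule.span ℂ {Z | ∃ X Y : Matrix (Fin n) (Fin n) A, Z = X * Y - Y * X} := by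
    intro g hg
    induction hg using Submodule.span_induction with
    | mem z hz =>
      obtain ⟨x, y, rfl⟩ := hz
      exact Submodule.subset_span ⟨D x, D y, by simp only [hDsub, hDmul]⟩
    | zero => simp [D]
    | add x y _ _ hx hy => rw [hDadd]; exact add_mem hx hy
    | smul c x _ hx => rw [hDsmul]; exact Submodule.smul_mem _ c hx
  obtain ⟨X, Y, hXY, hsum⟩ := hMn (D h) (fun δ hδ => by
    obtain ⟨g, hg, hgδ⟩ := hclosure δ hδ
    exact ⟨D g, hDspan g hg, by rwa [← hDsub, hDnorm]⟩) ε hε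
  rw [hDnorm] at hsum
  set E := D h - ∑ i, (X i * Y i - Y i * X i) with hE
  let e : Fin (m * n ^ 2) ≃ Fin m × Fin n × Fin n :=
    Fintype.equivOfCardEq (by simp [sq])
  have hn0 : (n : ℂ) ≠ 0 := Nat.cast_ne_zero.2 hn.ne'
  have hnR : (0 : ℝ) < n := Nat.cast_pos.2 hn
  refine ⟨fun q => (n : ℂ)⁻¹ • X (e q).1 (e q).2.1 (e q).2.2,
    fun q => Y (e q).1 (e q).2.2 (e q).2.1, ?_, ?_⟩
  · have htrace : h - ∑ q, ((n : ℂ)⁻¹ • X (e q).1 (e q).2.1 (e q).2.2 *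
          Y (e q).1 (e q).2.2 (e q).2.1 - Y (e q).1 (e q).2.2 (e q).2.1 *
          (n : ℂ)⁻¹ • X (e q).1 (e q).2.1 (e q).2.2) = (n : ℂ)⁻¹ • E.trace := by
      rw [e.sum_comp fun p => ((n : ℂ)⁻¹ • X p.1 p.2.1 p.2.2 * Y p.1 p.2.2 p.2.1 -
          Y p.1 p.2.2 p.2.1 * (n : ℂ)⁻¹ • X p.1 p.2.1 p.2.2), Fintype.sum_prod_type, hE,
        Matrix.trace_sub, Matrix.trace_sum]
      simp only [smul_mul_assoc, mul_smul_comm, ← smul_sub, ← Finset.smul_sum,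
        Matrix.trace_mul_sub_mul]
      rw [smul_sub]
      congr 1
      simp only [D, Matrix.trace_diagonal, Finset.sum_const, Finset.card_univ, Fintype.card_fin]
      rw [← Nat.cast_smul_eq_nsmul ℂ, inv_smul_smul₀ hn0]
    have hle : ‖E.trace‖ ≤ n * Nm E := by
      refine (norm_sum_le _ _).trans ((Finset.sum_le_sum fun i _ => hentry E i i).trans ?_)
      simp
    change ‖_‖ < ε
    rw [htrace, norm_smul, norm_inv, Complex.norm_natCast, inv_mul_lt_iff₀ hnR]
    exact hle.trans_lt (mul_lt_mul_of_pos_left hXY hnR)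
  · change ∑ q, ‖(n : ℂ)⁻¹ • X (e q).1 (e q).2.1 (e q).2.2‖ *
      ‖Y (e q).1 (e q).2.2 (e q).2.1‖ ≤ C * n * ‖h‖
    rw [e.sum_comp fun p => ‖(n : ℂ)⁻¹ • X p.1 p.2.1 p.2.2‖ * ‖Y p.1 p.2.2 p.2.1‖,
      Fintype.sum_prod_type]
    calc ∑ i, ∑ p : Fin n × Fin n, ‖(n : ℂ)⁻¹ • X i p.1 p.2‖ * ‖Y i p.2 p.1‖
        ≤ ∑ i, ∑ _p : Fin n × Fin n, (n : ℝ)⁻¹ * (Nm (X i) * Nm (Y i)) := by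
          refine Finset.sum_le_sum fun i _ => Finset.sum_le_sum fun p _ => ?_
          rw [norm_smul, norm_inv, Complex.norm_natCast, mul_assoc]
          gcongr
          · exact hNnonneg _
          · exact hentry _ _ _
          · exact hentry _ _ _
      _ = n * ∑ i, Nm (X i) * Nm (Y i) := by
          simp only [Finset.sum_const, Finset.card_univ, Fintype.card_prod, Fintype.card_fin,
            nsmul_eq_mul, Finset.mul_sum, Nat.cast_mul]
          refine Finset.sum_congr rfl fun i _ => ?_
          field_simp
      _ ≤ n * (C * ‖h‖) := by gcongr
      _ = C * n * ‖h‖ := by ring
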